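/- arXiv:math/0403374 — 2 statements merged into one kernel-verified Lean document; each statement's English description precedes it below -/
import Mathlib

section
/- The elliptic curve over Q given by the Weierstrass equation y^2 + xy = x^3 - x^2 - 1536664x + 648294124 (coefficients [a1,a2,a3,a4,a6] = [1,-1,0,-1536664,648294124]) has discriminant of absolute value 50881111474471687972, and its group of rational points contains 10 points that are linearly independent over Z (so the curve has Mordell–Weil rank at least 10). -/
open Polynomial in
/-- Simple roots modulo `p` of an integral polynomial lift to `ℤ_[p]`. -/
theorem PadicInt.exists_root_of_simple_root {p : ℕ} [Fact p.Prime] (f : ℤ[X]) (r : ZMod p)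
    (hr : aeval r f = 0) (hr' : aeval r (derivative f) ≠ 0) :
    ∃ z : ℤ_[p], aeval z f = 0 ∧ PadicInt.toZMod z = r := by
  have norm_lt (z : ℤ_[p]) : ‖z‖ < 1 ↔ PadicInt.toZMod z = 0 := by
    rw [← PadicInt.mem_nonunits, ← IsLocalRing.mem_maximalIdeal, ← PadicInt.ker_toZMod,
      RingHom.mem_ker]
  have map_aeval (z : ℤ_[p]) (g : ℤ[X]) :
      PadicInt.toZMod (aeval z g) = aeval (PadicInt.toZMod z) g := by
    rw [aeval_def, aeval_def, hom_eval₂]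
    congr 1
    exact RingHom.ext_int _ _
  obtain ⟨a, ha⟩ : ∃ a : ℤ_[p], PadicInt.toZMod a = r := ⟨r.val, by simp⟩
  have h1 : ‖aeval a (derivative f)‖ = 1 := by
    refine le_antisymm (PadicInt.norm_le_one _) (not_lt.1 fun h => hr' ?_)
    rwa [norm_lt, map_aeval, ha] at h
  have h0 : ‖aeval a f‖ < ‖aeval a (derivative f)‖ ^ 2 := by
    rwa [h1, one_pow, norm_lt, map_aeval, ha]
  obtain ⟨z, hz, hza, -⟩ := hensels_lemma h0
  refine ⟨z, hz, ?_⟩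
  rwa [h1, norm_lt, map_sub, sub_eq_zero, ha] at hza

namespace Padic

variable {p : ℕ} [Fact p.Prime]

theorem norm_mul_zpow_neg_valuation {x : ℚ_[p]} (hx : x ≠ 0) :
    ‖x * (p : ℚ_[p]) ^ (-x.valuation)‖ = 1 := by
  have hp : (p : ℝ) ≠ 0 := mod_cast (Fact.out : p.Prime).ne_zero
  rw [norm_mul, norm_zpow, Padic.norm_p, norm_eq_zpow_neg_valuation hx, inv_zpow, ← zpow_neg,
    neg_neg, ← zpow_add₀ hp, neg_add_cancel, zpow_zero]

/-- The cofactor of `p ^ x.valuation` in a `p`-adic number `x`. -/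
noncomputable def unitPart (x : ℚ_[p]) : ℤ_[p] :=
  ⟨x * (p : ℚ_[p]) ^ (-x.valuation), by
    rcases eq_or_ne x 0 with rfl | hx
    · simp
    · exact (norm_mul_zpow_neg_valuation hx).le⟩

theorem unitPart_mul {x y : ℚ_[p]} (hx : x ≠ 0) (hy : y ≠ 0) :
    unitPart (x * y) = unitPart x * unitPart y := by
  have hp : (p : ℚ_[p]) ≠ 0 := mod_cast (Fact.out : p.Prime).ne_zero
  apply Subtype.ext
  rw [PadicInt.coe_mul]
  simp only [unitPart, valuation_mul hx hy, neg_add, zpow_add₀ hp]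
  ring

theorem toZMod_unitPart_ne_zero {x : ℚ_[p]} (hx : x ≠ 0) : PadicInt.toZMod (unitPart x) ≠ 0 := by
  intro h
  rw [← RingHom.mem_ker, PadicInt.ker_toZMod, IsLocalRing.mem_maximalIdeal,
    PadicInt.mem_nonunits, PadicInt.norm_def] at h
  exact h.ne (norm_mul_zpow_neg_valuation hx)

theorem unitPart_coe {z : ℤ_[p]} (hz : PadicInt.toZMod z ≠ 0) : unitPart (z : ℚ_[p]) = z := by
  have hz1 : ‖z‖ = 1 := by
    rw [← PadicInt.isUnit_iff]
    by_contra h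
    exact hz (by rwa [← RingHom.mem_ker, PadicInt.ker_toZMod, IsLocalRing.mem_maximalIdeal])
  have hz0 : (z : ℚ_[p]) ≠ 0 := by
    rw [← norm_ne_zero_iff, ← PadicInt.norm_def, hz1]
    exact one_ne_zero
  have hv : (z : ℚ_[p]).valuation = 0 := by
    have hp : 1 < (p : ℝ) := mod_cast (Fact.out : p.Prime).one_lt
    rw [PadicInt.norm_def, norm_eq_zpow_neg_valuation hz0] at hz1
    simpa using (zpow_eq_one_iff_right₀ (by positivity) hp.ne').1 hz1
  apply Subtype.ext
  simp [unitPart, hv]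

/-- The quadratic residue symbol of the unit part of a `p`-adic number, written additively. -/
noncomputable def residueSymbol (x : ℚ_[p]) : ZMod 2 :=
  if IsSquare (PadicInt.toZMod (unitPart x)) then 0 else 1

theorem residueSymbol_mul {x y : ℚ_[p]} (hx : x ≠ 0) (hy : y ≠ 0) :
    residueSymbol (x * y) = residueSymbol x + residueSymbol y := by
  have ha := toZMod_unitPart_ne_zero hx
  have hb := toZMod_unitPart_ne_zero hy
  have hab := mul_ne_zero ha hb
  unfold residueSymbol
  rw [unitPart_mul hx hy, map_mul]
  simp only [← quadraticChar_one_iff_isSquare ha, ← quadraticChar_one_iff_isSquare hb,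
    ← quadraticChar_one_iff_isSquare hab, map_mul]
  rcases quadraticChar_dichotomy ha with h | h <;> rcases quadraticChar_dichotomy hb with h' | h' <;>
    simp [h, h', CharTwo.add_self_eq_zero]

end Padic

namespace WeierstrassCurve.Affine.Point

variable {F K : Type*} [Field F] [DecidableEq F] [Field K] {W : Affine F}

/-- The map `(x, y) ↦ χ (x - e)` underlying a `2`-descent. -/
def descentFun (ι : F →+* K) (χ : K → ZMod 2) (e : K) : W.Point → ZMod 2
  | .zero => 0
  | .some x _ _ => χ (ι x - e)

open Polynomial in
theorem four_mul_prod_sub_eq_sq (ι : F →+* K) {e : K}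
    (he : 4 * e ^ 3 + ι W.b₂ * e ^ 2 + 2 * ι W.b₄ * e + ι W.b₆ = 0) {x₁ x₂ y₁ y₂ : F}
    (h₁ : W.Equation x₁ y₁) (h₂ : W.Equation x₂ y₂) (hxy : ¬(x₁ = x₂ ∧ y₁ = W.negY x₂ y₂)) :
    ∃ t : K, 2 * 2 * ((ι x₁ - e) * (ι x₂ - e) *
      (ι (W.addX x₁ x₂ (W.slope x₁ x₂ y₁ y₂)) - e)) = t * t := by
  have h := congrArg (eval₂ ι e) (addPolynomial_slope h₁ h₂ hxy)
  rw [addPolynomial_eq] at h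
  simp only [Cubic.toPoly, eval₂_neg, eval₂_add, eval₂_mul, eval₂_sub, eval₂_C, eval₂_X,
    eval₂_X_pow] at h
  simp only [map_add, map_sub, map_mul, map_neg, map_pow, map_one, map_ofNat] at h
  simp only [b₂, b₄, b₆, map_add, map_mul, map_pow, map_ofNat] at he
  refine ⟨2 * (ι (W.slope x₁ x₂ y₁ y₂) * (e - ι x₁) + ι y₁) + ι W.a₁ * e + ι W.a₃, ?_⟩
  linear_combination (-4) * h - he

/-- A quadratic character `χ` turns `x - e` into a homomorphism on the group of points. -/
def descentHom (ι : F →+* K) (χ : K → ZMod 2)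
    (hχ : ∀ a b : K, a ≠ 0 → b ≠ 0 → χ (a * b) = χ a + χ b) (h2 : (2 : K) ≠ 0) (e : K)
    (he : 4 * e ^ 3 + ι W.b₂ * e ^ 2 + 2 * ι W.b₄ * e + ι W.b₆ = 0)
    (hne : ∀ x : F, ι x ≠ e) : W.Point →+ ZMod 2 where
  toFun := descentFun ι χ e
  map_zero' := rfl
  map_add' := by
    have hne' (x : F) : ι x - e ≠ 0 := sub_ne_zero.2 (hne x)
    have sq {a : K} (ha : a ≠ 0) : χ (a * a) = 0 := by
      rw [hχ a a ha ha, CharTwo.add_self_eq_zero]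
    rintro (_ | ⟨x₁, y₁, h₁⟩) (_ | ⟨x₂, y₂, h₂⟩)
    any_goals simp only [← zero_def, zero_add, add_zero]
    any_goals simp only [descentFun, zero_add, add_zero]
    by_cases hxy : x₁ = x₂ ∧ y₁ = W.negY x₂ y₂
    · rw [add_of_Y_eq hxy.1 hxy.2, hxy.1, CharTwo.add_self_eq_zero]
    · rw [add_some hxy]
      obtain ⟨t, ht⟩ := four_mul_prod_sub_eq_sq ι he h₁.1 h₂.1 hxy
      set x₃ := W.addX x₁ x₂ (W.slope x₁ x₂ y₁ y₂)
      have h12 := mul_ne_zero (hne' x₁) (hne' x₂)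
      have h123 := mul_ne_zero h12 (hne' x₃)
      have ht0 : t ≠ 0 := by
        rintro rfl
        rw [mul_zero] at ht
        exact mul_ne_zero (mul_ne_zero h2 h2) h123 ht
      have h := congrArg χ ht
      rw [hχ _ _ (mul_ne_zero h2 h2) h123, sq h2, sq ht0, hχ _ _ h12 (hne' x₃),
        hχ _ _ (hne' x₁) (hne' x₂), zero_add] at h
      change χ (ι x₃ - e) = _
      rw [← CharTwo.neg_eq (χ (ι x₃ - e))]
      exact (eq_neg_of_add_eq_zero_left h).symm

/-- A point of order `2` yields a root of the `2`-torsion polynomial. -/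
theorem eq_zero_of_add_self_eq_zero
    (hW : ∀ x : F, 4 * x ^ 3 + W.b₂ * x ^ 2 + 2 * W.b₄ * x + W.b₆ ≠ 0) (P : W.Point)
    (hP : P + P = 0) : P = 0 := by
  rcases P with _ | ⟨x, y, h⟩
  · rfl
  · by_cases hy : y = W.negY x y
    · refine absurd ?_ (hW x)
      have h' := (equation_iff ..).1 h.1
      rw [negY] at hy
      simp only [b₂, b₄, b₆]
      linear_combination (-4) * h' + (2 * y + W.a₁ * x + W.a₃) * hy
    · rw [add_self_of_Y_ne hy] at hP
      exact absurd hP (some_ne_zero _)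

end WeierstrassCurve.Affine.Point

/-- In a group without `2`-torsion, elements are independent as soon as their images under some
homomorphisms to `ℤ/2` form a matrix of full rank. -/
theorem linearIndependent_int_of_homs {A ι κ : Type*} [AddCommGroup A] [Fintype ι] [Fintype κ]
    [DecidableEq ι] (hA : ∀ a : A, a + a = 0 → a = 0) (P : ι → A) (φ : κ → A →+ ZMod 2)
    (N : Matrix ι κ (ZMod 2)) (hN : N * Matrix.of (fun j i => φ j (P i)) = 1) :
    LinearIndependent ℤ P := by
  have key (n : ℕ) : ∀ c : ι → ℤ, ∑ i, c i • P i = 0 → ∀ i, (2 : ℤ) ^ n ∣ c i := by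
    induction n with
    | zero => simp
    | succ n ih =>
      intro c hc
      have hker : Matrix.mulVec (Matrix.of fun j i => φ j (P i)) (fun i => (c i : ZMod 2)) = 0 := by
        ext j
        have h := congrArg (φ j) hc
        simp only [map_sum, map_zsmul, map_zero, zsmul_eq_mul] at h
        simpa [Matrix.mulVec, dotProduct, mul_comm] using h
      have hc0 : (fun i => (c i : ZMod 2)) = 0 := by
        rw [← Matrix.one_mulVec (fun i => (c i : ZMod 2)), ← hN, ← Matrix.mulVec_mulVec, hker,
          Matrix.mulVec_zero]
      have heven (i : ι) : ∃ d : ℤ, c i = 2 * d :=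
        (ZMod.intCast_zmod_eq_zero_iff_dvd (c i) 2).1 (congrFun hc0 i)
      choose d hd using heven
      have hsum : ∑ i, d i • P i = 0 := by
        apply hA
        rw [← Finset.sum_add_distrib, ← hc]
        exact Finset.sum_congr rfl fun i _ => by rw [hd, ← add_zsmul, two_mul]
      intro i
      rw [hd, pow_succ']
      exact mul_dvd_mul_left 2 (ih d hsum i)
  rw [Fintype.linearIndependent_iff]
  intro c hc i
  by_contra h
  have hle := Int.le_of_dvd (abs_pos.2 h) ((dvd_abs _ _).2 (key (c i).natAbs c hc i))
  have hlt : ((c i).natAbs : ℤ) < 2 ^ (c i).natAbs := mod_cast Nat.lt_two_pow_self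
  rw [Int.natCast_natAbs] at hlt
  exact absurd hle (not_le.2 hlt)

namespace LowDiscriminantCurve

/-- The curve `y² + xy = x³ - x² - 1536664x + 648294124`. -/
abbrev curve : WeierstrassCurve ℚ := ⟨1, -1, 0, -1536664, 648294124⟩

theorem twoTorsion_ne_zero (x : ℚ) :
    4 * x ^ 3 + -3 * x ^ 2 + 2 * -3073328 * x + 2593176496 ≠ 0 := by
  intro h
  have hroot : Polynomial.aeval (4 * x) (Polynomial.X ^ 3 + (Polynomial.C (-3) * Polynomial.X ^ 2 +
      Polynomial.C (-24586624) * Polynomial.X + Polynomial.C 41490823936) : Polynomial ℤ) = 0 := by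
    simp [map_ofNat]
    linear_combination 16 * h
  have hmonic : (Polynomial.X ^ 3 + (Polynomial.C (-3) * Polynomial.X ^ 2 +
      Polynomial.C (-24586624) * Polynomial.X + Polynomial.C 41490823936) :
      Polynomial ℤ).Monic := by
    monicity!
  obtain ⟨u, hu⟩ := isInteger_of_is_root_of_monic hmonic hroot
  have hu' : u ^ 3 + (-3 * u ^ 2 + -24586624 * u + 41490823936) = 0 := by
    have hu : (u : ℚ) = 4 * x := by simpa using hu
    have : (u : ℚ) ^ 3 + (-3 * u ^ 2 + -24586624 * u + 41490823936) = 0 := by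
      rw [hu]
      linear_combination 16 * h
    exact_mod_cast this
  have hmod := congrArg (Int.cast : ℤ → ZMod 3) hu'
  push_cast at hmod
  exact absurd hmod ((by decide : ∀ v : ZMod 3,
    v ^ 3 + (-3 * v ^ 2 + -24586624 * v + 41490823936) ≠ 0) u)

/-- The `x`-coordinates of ten independent integral points. -/
def xs : Fin 10 → ℤ := ![-18, 36, -60, -86, 89, 114, 145, -153, 220, 245]

/-- The `y`-coordinates of ten independent integral points. -/
def ys : Fin 10 → ℤ := ![26008, 24334, 27238, 27968, 22588, 21728, 20628, 29738, 17802, 16803]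

theorem nonsingular (i : Fin 10) : curve.toAffine.Nonsingular (xs i) (ys i) := by
  have hΔ : curve.toAffine.Δ ≠ 0 := by
    norm_num [WeierstrassCurve.Δ, WeierstrassCurve.b₂, WeierstrassCurve.b₄, WeierstrassCurve.b₆,
      WeierstrassCurve.b₈]
  rw [← WeierstrassCurve.Affine.equation_iff_nonsingular_of_Δ_ne_zero hΔ,
    WeierstrassCurve.Affine.equation_iff]
  have h : ∀ i, ys i ^ 2 + 1 * xs i * ys i + 0 * ys i =
      xs i ^ 3 + -1 * xs i ^ 2 + -1536664 * xs i + 648294124 := by decide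
  simpa using congrArg (Int.cast : ℤ → ℚ) (h i)

/-- Ten independent integral points. -/
def points (i : Fin 10) : curve.toAffine.Point := .some _ _ (nonsingular i)

theorem exists_hom {p : ℕ} (hp : p.Prime) (r : ZMod p)
    (hr : 4 * r ^ 3 + -3 * r ^ 2 + 2 * -3073328 * r + 2593176496 = 0)
    (hr' : 12 * r ^ 2 - 6 * r - 6146656 ≠ 0) (v : Fin 10 → ZMod 2)
    (hv : ∀ i, (xs i : ZMod p) - r ≠ 0 ∧
      (v i = 0 ↔ IsSquare ((xs i : ZMod p) - r))) :
    ∃ φ : curve.toAffine.Point →+ ZMod 2, ∀ i, φ (points i) = v i := by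
  have : Fact p.Prime := ⟨hp⟩
  obtain ⟨e, he, rfl⟩ := PadicInt.exists_root_of_simple_root
    (4 * Polynomial.X ^ 3 + -3 * Polynomial.X ^ 2 + 2 * -3073328 * Polynomial.X + 2593176496) r
    (by simpa [map_ofNat] using hr) (by
      convert! hr' using 1
      simp [map_ofNat]
      ring)
  have he' : (4 * (e : ℚ_[p]) ^ 3 + -3 * (e : ℚ_[p]) ^ 2 + 2 * -3073328 * (e : ℚ_[p]) +
      2593176496) = 0 := by
    have h := congrArg PadicInt.Coe.ringHom he
    simp only [map_add, map_mul, map_pow, map_neg, map_ofNat, map_zero, Polynomial.aeval_X] at h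
    exact h
  refine ⟨WeierstrassCurve.Affine.Point.descentHom (Rat.castHom ℚ_[p]) Padic.residueSymbol
    (fun _ _ => Padic.residueSymbol_mul) two_ne_zero e ?_ ?_, fun i => ?_⟩
  · rw [← he']
    norm_num [WeierstrassCurve.b₂, WeierstrassCurve.b₄, WeierstrassCurve.b₆]
  · rintro x hx
    rw [← hx] at he'
    simp only [eq_ratCast] at he'
    exact twoTorsion_ne_zero x (by exact_mod_cast he')
  · obtain ⟨h0, h1⟩ := hv i
    have hred : PadicInt.toZMod ((xs i : ℤ_[p]) - e) = (xs i : ZMod p) - PadicInt.toZMod e := by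
      simp
    change Padic.residueSymbol (((xs i : ℚ) : ℚ_[p]) - (e : ℚ_[p])) = _
    have hcoe : ((xs i : ℚ) : ℚ_[p]) - (e : ℚ_[p]) = ((xs i - e : ℤ_[p]) : ℚ_[p]) := by simp
    rw [hcoe, Padic.residueSymbol, Padic.unitPart_coe (by rwa [hred]), hred]
    split_ifs with h
    · exact (h1.2 h).symm
    · exact ((by decide : ∀ a : ZMod 2, a ≠ 0 → 1 = a) (v i) (mt h1.1 h))

/-- The values at `points` of ten quadratic characters. -/
def symbols : Matrix (Fin 10) (Fin 10) (ZMod 2) :=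
  !![1, 0, 1, 0, 0, 1, 0, 0, 1, 1;
     1, 1, 1, 1, 0, 0, 0, 0, 1, 1;
     1, 0, 1, 1, 0, 1, 0, 1, 0, 0;
     1, 0, 0, 1, 0, 0, 1, 1, 1, 1;
     0, 1, 1, 1, 0, 0, 0, 0, 0, 1;
     1, 1, 0, 0, 0, 0, 0, 0, 1, 1;
     1, 0, 0, 0, 0, 1, 0, 1, 0, 1;
     0, 0, 1, 1, 1, 1, 0, 1, 1, 0;
     1, 1, 0, 1, 0, 0, 0, 1, 1, 1;
     1, 0, 1, 0, 0, 0, 0, 0, 0, 1]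

theorem exists_hom_eq_symbols (j : Fin 10) :
    ∃ φ : curve.toAffine.Point →+ ZMod 2, ∀ i, φ (points i) = symbols j i := by
  fin_cases j
  · exact exists_hom (by norm_num : Nat.Prime 7) 4 (by decide) (by decide) _ (by decide)
  · exact exists_hom (by norm_num : Nat.Prime 17) 13 (by decide) (by decide) _ (by decide)
  · exact exists_hom (by norm_num : Nat.Prime 19) 6 (by decide) (by decide) _ (by decide)
  · exact exists_hom (by norm_num : Nat.Prime 29) 3 (by decide) (by decide) _ (by decide)
  · exact exists_hom (by norm_num : Nat.Prime 37) 31 (by decide) (by decide) _ (by decide)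
  · exact exists_hom (by norm_num : Nat.Prime 41) 12 (by decide) (by decide) _ (by decide)
  · exact exists_hom (by norm_num : Nat.Prime 47) 0 (by decide) (by decide) _ (by decide)
  · exact exists_hom (by norm_num : Nat.Prime 59) 0 (by decide) (by decide) _ (by decide)
  · exact exists_hom (by norm_num : Nat.Prime 71) 25 (by decide) (by decide) _ (by decide)
  · exact exists_hom (by norm_num : Nat.Prime 83) 3 (by decide) (by decide) _ (by decide)

/-- The inverse of `symbols`. -/
def symbolsInv : Matrix (Fin 10) (Fin 10) (ZMod 2) :=
  !![1, 0, 0, 0, 1, 0, 1, 0, 1, 0;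
     0, 0, 1, 0, 1, 0, 1, 0, 0, 0;
     1, 1, 1, 0, 1, 1, 0, 0, 1, 1;
     1, 0, 1, 0, 1, 0, 0, 0, 1, 1;
     0, 1, 1, 0, 1, 0, 0, 1, 0, 0;
     0, 1, 0, 0, 0, 0, 1, 0, 1, 1;
     0, 0, 1, 1, 1, 0, 1, 0, 1, 0;
     1, 0, 1, 0, 1, 1, 0, 0, 0, 1;
     1, 1, 0, 0, 0, 0, 1, 0, 1, 0;
     0, 1, 1, 0, 0, 1, 1, 0, 0, 0]

theorem linearIndependent_points : LinearIndependent ℤ points := by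
  choose φ hφ using exists_hom_eq_symbols
  refine linearIndependent_int_of_homs
    (WeierstrassCurve.Affine.Point.eq_zero_of_add_self_eq_zero fun x => ?_) points φ symbolsInv ?_
  · convert! twoTorsion_ne_zero x using 1
    norm_num [WeierstrassCurve.b₂, WeierstrassCurve.b₄, WeierstrassCurve.b₆]
  · simp only [hφ]
    exact (by decide : symbolsInv * symbols = 1)

end LowDiscriminantCurve

/-- The elliptic curve `[1, -1, 0, -1536664, 648294124]` has discriminant of absolute value `50881111474471687972`,
and its group of rational points contains `10` points that are linearly independent
over `ℤ` (so its Mordell–Weil rank is at least `10`). -/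
theorem rank10_low_discriminant_curve (W : WeierstrassCurve ℚ)
    (hW : W = ⟨1, -1, 0, -1536664, 648294124⟩) :
    |W.Δ| = 50881111474471687972 ∧
      ∃ P : Fin 10 → W.toAffine.Point, LinearIndependent ℤ P := by
  subst hW
  refine ⟨?_, LowDiscriminantCurve.points, LowDiscriminantCurve.linearIndependent_points⟩
  norm_num [WeierstrassCurve.Δ, WeierstrassCurve.b₂, WeierstrassCurve.b₄, WeierstrassCurve.b₆,
    WeierstrassCurve.b₈]
end

section
/- The elliptic curve over Q given by the Weierstrass equation y^2 + xy = x^3 - x^2 - 222751x + 40537273 (coefficients [a1,a2,a3,a4,a6] = [1,-1,0,-222751,40537273]) has discriminant of absolute value 2 * 292246301470558 = 584492602941116, and its group of rational points contains 8 points that are linearly independent over Z (so the curve has Mordell–Weil rank at least 8). -/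
open Polynomial

namespace WeierstrassCurve.Affine

section TwoDescent

variable {F K : Type*} [Field F] [DecidableEq F] [Field K] [Algebra F K]

/-- The image of a rational point under `x - θ`, with the point at infinity mapped to `1`. -/
def Point.xSub {W : Affine F} (θ : K) : W.Point → K
  | .zero => 1
  | .some x _ _ => algebraMap F K x - θ

/-- If `(θ, η)` is a `2`-torsion point of `W` over an extension field, then `x - θ` is
multiplicative modulo squares. -/
lemma Point.isSquare_xSub_add {W : Affine F} {θ η : K}
    (hη : 2 * η + algebraMap F K W.a₁ * θ + algebraMap F K W.a₃ = 0)
    (hθ : η ^ 2 + algebraMap F K W.a₁ * θ * η + algebraMap F K W.a₃ * η =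
      θ ^ 3 + algebraMap F K W.a₂ * θ ^ 2 + algebraMap F K W.a₄ * θ + algebraMap F K W.a₆)
    (P Q : W.Point) : IsSquare ((P + Q).xSub θ * (P.xSub θ * Q.xSub θ)) := by
  rcases P with _ | ⟨x₁, y₁, h₁⟩
  · change IsSquare ((0 + Q).xSub θ * (1 * Q.xSub θ))
    rw [zero_add, one_mul]
    exact ⟨_, rfl⟩
  rcases Q with _ | ⟨x₂, y₂, h₂⟩
  · change IsSquare ((Point.some x₁ y₁ h₁ + 0).xSub θ * ((Point.some x₁ y₁ h₁).xSub θ * 1))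
    rw [add_zero, mul_one]
    exact ⟨_, rfl⟩
  by_cases hxy : x₁ = x₂ ∧ y₁ = W.negY x₂ y₂
  · rw [Point.add_of_Y_eq hxy.1 hxy.2]
    change IsSquare (1 * ((algebraMap F K x₁ - θ) * (algebraMap F K x₂ - θ)))
    rw [hxy.1, one_mul]
    exact ⟨_, rfl⟩
  · rw [Point.add_some hxy]
    set ℓ := W.slope x₁ x₂ y₁ y₂ with hℓ
    change IsSquare ((algebraMap F K (W.addX x₁ x₂ ℓ) - θ) *
      ((algebraMap F K x₁ - θ) * (algebraMap F K x₂ - θ)))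
    have h := congrArg (aeval θ) (addPolynomial_slope h₁.1 h₂.1 hxy)
    rw [← hℓ, addPolynomial_eq, Cubic.toPoly] at h
    simp only [map_neg, map_add, map_sub, map_mul, map_pow, map_one, map_ofNat, aeval_C, aeval_X]
      at h
    refine ⟨algebraMap F K ℓ * (θ - algebraMap F K x₁) + algebraMap F K y₁ - η, ?_⟩
    linear_combination hθ - h +
      (algebraMap F K ℓ * (θ - algebraMap F K x₁) + algebraMap F K y₁ - η) * hη

/-- The `x - θ` homomorphism of `2`-descent, for a `2`-torsion point `(θ, η)` over an extension
field whose abscissa is not rational. -/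
noncomputable def Point.xSubClass {W : Affine F} {θ η : K}
    (hη : 2 * η + algebraMap F K W.a₁ * θ + algebraMap F K W.a₃ = 0)
    (hθ : η ^ 2 + algebraMap F K W.a₁ * θ * η + algebraMap F K W.a₃ * η =
      θ ^ 3 + algebraMap F K W.a₂ * θ ^ 2 + algebraMap F K W.a₄ * θ + algebraMap F K W.a₆)
    (h0 : ∀ P : W.Point, P.xSub θ ≠ 0) :
    W.Point →+ Additive (Kˣ ⧸ (powMonoidHom 2 : Kˣ →* Kˣ).range) :=
  AddMonoidHom.mk' (fun P : W.Point ↦ Additive.ofMul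
      (QuotientGroup.mk' (powMonoidHom 2 : Kˣ →* Kˣ).range (Units.mk0 _ (h0 P)))) fun P Q ↦ by
    rw [← ofMul_mul, ← map_mul]
    refine congrArg _ (QuotientGroup.eq.mpr ?_)
    obtain ⟨z, hz⟩ := Point.isSquare_xSub_add hη hθ P Q
    have hz0 : z ≠ 0 := by
      rintro rfl
      exact mul_ne_zero (h0 _) (mul_ne_zero (h0 P) (h0 Q)) (by simpa using hz)
    refine ⟨Units.mk0 _ hz0 / Units.mk0 _ (h0 (P + Q)), ?_⟩
    ext
    have := h0 (P + Q)
    simp only [powMonoidHom_apply, Units.val_pow_eq_pow_val, Units.val_div_eq_div_val,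
      Units.val_mk0, Units.val_mul, Units.val_inv_eq_inv_val]
    field_simp
    linear_combination -hz

/-- A relation among points gives a square product of the values of `x - θ`. -/
lemma Point.exists_prod_xSub_eq_sq {ι : Type*} [Fintype ι] {W : Affine F} {θ η : K}
    (hη : 2 * η + algebraMap F K W.a₁ * θ + algebraMap F K W.a₃ = 0)
    (hθ : η ^ 2 + algebraMap F K W.a₁ * θ * η + algebraMap F K W.a₃ * η =
      θ ^ 3 + algebraMap F K W.a₂ * θ ^ 2 + algebraMap F K W.a₄ * θ + algebraMap F K W.a₆)
    (h0 : ∀ P : W.Point, P.xSub θ ≠ 0) {P : ι → W.Point} {c : ι → ℤ}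
    (hc : ∑ i, c i • P i = 0) : ∃ z : Kˣ, ∏ i, Units.mk0 _ (h0 (P i)) ^ c i = z ^ 2 := by
  have h := (congrArg (Point.xSubClass hη hθ h0) hc).trans (Point.xSubClass hη hθ h0).map_zero
  simp only [map_sum, map_zsmul] at h
  have h' := congrArg Additive.toMul h
  simp only [toMul_sum, toMul_zsmul, toMul_zero] at h'
  have h'' : (QuotientGroup.mk (∏ i, Units.mk0 _ (h0 (P i)) ^ c i) :
      Kˣ ⧸ (powMonoidHom 2 : Kˣ →* Kˣ).range) = 1 := by
    rw [← h']
    exact map_prod (QuotientGroup.mk' _) _ _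
  obtain ⟨z, hz⟩ := (QuotientGroup.eq_one_iff _).mp h''
  exact ⟨z, hz.symm⟩

end TwoDescent

/-- A point with vanishing double is zero when the `2`-division polynomial has no root. -/
lemma Point.eq_zero_of_two_nsmul_eq_zero {F : Type*} [Field F] [DecidableEq F] {W : Affine F}
    (hW : ∀ x : F, 4 * x ^ 3 + W.b₂ * x ^ 2 + 2 * W.b₄ * x + W.b₆ ≠ 0)
    {P : W.Point} (hP : 2 • P = 0) : P = 0 := by
  rcases P with _ | ⟨x, y, h⟩
  · rfl
  exfalso
  rw [two_nsmul] at hP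
  by_cases hy : y = W.negY x y
  · apply hW x
    have he := (W.equation_iff x y).mp h.1
    rw [negY] at hy
    simp only [b₂, b₄, b₆]
    linear_combination (-4) * he + (2 * y + W.a₁ * x + W.a₃) * hy
  · rw [Point.add_of_Y_ne hy] at hP
    exact Point.some_ne_zero _ hP

end WeierstrassCurve.Affine

/-- If every integral relation has even coefficients and there is no `2`-torsion, then there are
no nontrivial relations. -/
lemma linearIndependent_of_forall_even {ι G : Type*} [Fintype ι] [AddCommGroup G] {P : ι → G}
    (htors : ∀ g : G, 2 • g = 0 → g = 0)
    (heven : ∀ c : ι → ℤ, ∑ i, c i • P i = 0 → ∀ i, Even (c i)) : LinearIndependent ℤ P := by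
  rw [Fintype.linearIndependent_iff]
  have hpow (n : ℕ) : ∀ c : ι → ℤ, ∑ i, c i • P i = 0 → ∀ i, 2 ^ n ∣ c i := by
    induction n with
    | zero => simp
    | succ n ih =>
      intro c hc i
      choose d hd using fun i ↦ (heven c hc i).two_dvd
      have hd0 : ∑ i, d i • P i = 0 := htors _ <| by
        rw [← hc, Finset.smul_sum]
        refine Finset.sum_congr rfl fun i _ ↦ ?_
        rw [hd i, mul_smul, ofNat_zsmul]
      rw [hd i, pow_succ']
      exact mul_dvd_mul_left 2 (ih d hd0 i)
  intro c hc i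
  by_contra hi
  obtain ⟨n, hn⟩ := pow_unbounded_of_one_lt |c i| (one_lt_two (α := ℤ))
  exact hn.not_ge (Int.le_of_dvd (abs_pos.mpr hi) ((dvd_abs _ _).mpr (hpow n c hc i)))

/-- Hensel lifting of a simple root modulo `p` of an integral polynomial. -/
lemma PadicInt.exists_root_toZMod_eq {p : ℕ} [Fact p.Prime] (f : ℤ[X]) (t : ℤ)
    (h : (p : ℤ) ∣ f.eval t) (h' : ¬ (p : ℤ) ∣ f.derivative.eval t) :
    ∃ θ : ℤ_[p], aeval θ f = 0 ∧ toZMod θ = t := by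
  have haeval (g : ℤ[X]) : aeval (t : ℤ_[p]) g = (g.eval t : ℤ) := by
    simpa using aeval_algebraMap_apply ℤ_[p] t g
  have h1 : ‖aeval (t : ℤ_[p]) f.derivative‖ = 1 := by
    rw [haeval]
    exact (norm_le_one _).antisymm (not_lt.mp fun hlt ↦ h' (norm_int_lt_one_iff_dvd _ |>.mp hlt))
  have h2 : ‖aeval (t : ℤ_[p]) f‖ < 1 := by
    rw [haeval]
    exact norm_int_lt_one_iff_dvd _ |>.mpr h
  obtain ⟨θ, hθ, hθt, -⟩ := hensels_lemma (F := f) (a := (t : ℤ_[p])) (by rw [h1]; simpa using h2)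
  refine ⟨θ, hθ, ?_⟩
  rw [h1] at hθt
  have : θ - t ∈ RingHom.ker (toZMod (p := p)) := by
    rw [ker_toZMod]
    exact (mem_nonunits).mpr hθt
  simpa [RingHom.mem_ker, sub_eq_zero] using this

/-- If a product of powers of `p`-adic units is a square and exactly one of the units is not a
square modulo `p`, then the corresponding exponent is even. -/
lemma PadicInt.even_of_prod_zpow_eq_sq {p : ℕ} [Fact p.Prime] {ι : Type*} [Fintype ι]
    {u : ι → ℤ_[p]} {v : ι → ℚ_[p]ˣ} (huv : ∀ i, (u i : ℚ_[p]) = v i) {c : ι → ℤ} {z : ℚ_[p]ˣ}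
    (hz : ∏ i, v i ^ c i = z ^ 2) {j : ι} (hj : quadraticChar (ZMod p) (toZMod (u j)) = -1)
    (hne : ∀ i ≠ j, quadraticChar (ZMod p) (toZMod (u i)) = 1) : Even (c j) := by
  have hunit (i : ι) : IsUnit (u i) := by
    by_contra hi
    have : toZMod (u i) = 0 := by
      rw [← RingHom.mem_ker, ker_toZMod]
      exact hi
    by_cases hij : i = j
    · subst hij
      simp [this] at hj
    · simpa [this] using hne i hij
  choose w hw using hunit
  let φ : ℤ_[p]ˣ →* ℚ_[p]ˣ := Units.map (Coe.ringHom (p := p))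
  have hφ : Function.Injective φ := Units.map_injective Subtype.val_injective
  have hφw (i : ι) : φ (w i) = v i := by
    ext
    rw [← huv, ← hw]
    rfl
  have hz' : φ (∏ i, w i ^ c i) = z ^ 2 := by
    simp only [map_prod, map_zpow, hφw, hz]
  have hnorm : ‖(z : ℚ_[p])‖ = 1 := by
    have h1 : ‖((φ (∏ i, w i ^ c i) : ℚ_[p]ˣ) : ℚ_[p])‖ = 1 := norm_units _
    rw [hz', Units.val_pow_eq_pow_val, norm_pow] at h1
    exact (pow_eq_one_iff_of_nonneg (norm_nonneg _) two_ne_zero).mp h1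
  obtain ⟨s, hs⟩ : ∃ s : ℤ_[p]ˣ, φ s = z := ⟨mkUnits hnorm, by ext; rfl⟩
  rw [← hs, ← map_pow] at hz'
  let χ : ℤ_[p]ˣ →* ℤˣ := Units.map
    ((quadraticChar (ZMod p)).toMonoidHom.comp (toZMod (p := p)).toMonoidHom)
  have hχ := congrArg χ (hφ hz')
  have hχj : χ (w j) = -1 := by
    ext
    simpa [χ, hw] using hj
  have hχi (i : ι) (hi : i ≠ j) : χ (w i) = 1 := by
    ext
    simpa [χ, hw] using hne i hi
  rw [map_prod, map_pow, Int.units_sq, Finset.prod_eq_single j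
    (fun i _ hi ↦ by rw [map_zpow, hχi i hi, one_zpow]) (by simp), map_zpow, hχj] at hχ
  by_contra hodd
  rw [Int.not_even_iff_odd] at hodd
  rw [hodd.neg_one_zpow] at hχ
  exact absurd hχ (by decide)

namespace RankEight

/-- The curve `[1, -1, 0, -222751, 40537273]`. -/
abbrev curve : WeierstrassCurve.Affine ℚ := ⟨1, -1, 0, -222751, 40537273⟩

/-- The `2`-division polynomial of the curve. -/
noncomputable def twoDivision : ℤ[X] := 4 * X ^ 3 - 3 * X ^ 2 - 891004 * X + 162149092

lemma twoDivision_eval_ne_zero (x : ℚ) : 4 * x ^ 3 - 3 * x ^ 2 - 891004 * x + 162149092 ≠ 0 := by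
  intro h
  have hx : x * x.den = x.num := Rat.mul_den_eq_num x
  have hq : 4 * (x.num : ℚ) ^ 3 - 3 * x.num ^ 2 * x.den - 891004 * x.num * x.den ^ 2
      + 162149092 * x.den ^ 3 = 0 := by
    rw [← hx]
    linear_combination (x.den : ℚ) ^ 3 * h
  have hz : 4 * x.num ^ 3 - 3 * x.num ^ 2 * x.den - 891004 * x.num * x.den ^ 2
      + 162149092 * (x.den : ℤ) ^ 3 = 0 := by exact_mod_cast hq
  have hmod : ∀ a b : ZMod 5, 4 * a ^ 3 - 3 * a ^ 2 * b - 891004 * a * b ^ 2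
      + 162149092 * b ^ 3 = 0 → a = 0 ∧ b = 0 := by decide
  obtain ⟨h1, h2⟩ := hmod x.num (x.den : ℤ) (by exact_mod_cast congrArg (Int.cast : ℤ → ZMod 5) hz)
  have h1' := (ZMod.intCast_zmod_eq_zero_iff_dvd _ 5).mp h1
  have h2' := (ZMod.intCast_zmod_eq_zero_iff_dvd _ 5).mp h2
  have := Nat.dvd_gcd (Int.natAbs_dvd_natAbs.mpr h1') (Int.natAbs_dvd_natAbs.mpr h2')
  simp only [Int.natAbs_natCast, Nat.Coprime.gcd_eq_one x.reduced] at this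
  norm_num at this

lemma two_nsmul_eq_zero (P : curve.Point) (hP : 2 • P = 0) : P = 0 :=
  WeierstrassCurve.Affine.Point.eq_zero_of_two_nsmul_eq_zero (fun x h ↦
    twoDivision_eval_ne_zero x (by
      simp only [WeierstrassCurve.b₂, WeierstrassCurve.b₄, WeierstrassCurve.b₆] at h
      linear_combination h)) hP

/-- A root `t` modulo `p` of the `2`-division polynomial detects the parity of a coefficient. -/
lemma even_coeff {p : ℕ} [Fact p.Prime] (t : ℤ)
    (ht : (p : ℤ) ∣ 4 * t ^ 3 - 3 * t ^ 2 - 891004 * t + 162149092)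
    (ht' : ¬ (p : ℤ) ∣ 12 * t ^ 2 - 6 * t - 891004)
    {ι : Type*} [Fintype ι] {a : ι → ℤ} {P : ι → curve.Point}
    (hP : ∀ i, ∃ y h, P i = .some (a i : ℚ) y h) {j : ι} (hj : legendreSym p (a j - t) = -1)
    (hne : ∀ i ≠ j, legendreSym p (a i - t) = 1) {c : ι → ℤ} (hc : ∑ i, c i • P i = 0) :
    Even (c j) := by
  obtain ⟨θ, hθ, hθt⟩ := PadicInt.exists_root_toZMod_eq (p := p) twoDivision t
    (by simpa [twoDivision] using ht) (by
      convert ht' using 2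
      simp [twoDivision]
      ring)
  have hθ' : 4 * (θ : ℚ_[p]) ^ 3 - 3 * (θ : ℚ_[p]) ^ 2 - 891004 * (θ : ℚ_[p]) + 162149092 = 0 := by
    simp only [twoDivision, map_add, map_sub, map_mul, map_pow, map_ofNat, aeval_X] at hθ
    exact_mod_cast congrArg (Subtype.val : ℤ_[p] → ℚ_[p]) hθ
  have h0 (Q : curve.Point) : Q.xSub (θ : ℚ_[p]) ≠ 0 := by
    rcases Q with _ | ⟨x, y, h⟩
    · exact one_ne_zero
    · intro hx
      apply twoDivision_eval_ne_zero x
      have hx' : (x : ℚ_[p]) = θ := sub_eq_zero.mp hx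
      rw [← hx'] at hθ'
      exact_mod_cast hθ'
  obtain ⟨z, hz⟩ := WeierstrassCurve.Affine.Point.exists_prod_xSub_eq_sq
    (W := curve) (K := ℚ_[p]) (θ := θ) (η := -θ / 2)
    (by simp; ring) (by simp; linear_combination -hθ' / 4) h0 hc
  refine PadicInt.even_of_prod_zpow_eq_sq (u := fun i ↦ (a i : ℤ_[p]) - θ) (fun i ↦ ?_) hz ?_
    fun i hi ↦ ?_
  · obtain ⟨y, h, hi⟩ := hP i
    simp [hi, WeierstrassCurve.Affine.Point.xSub]
  · simpa [legendreSym, hθt] using hj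
  · simpa [legendreSym, hθt] using hne i hi

/-- Abscissae of eight independent points. -/
def abscissa : Fin 8 → ℤ := ![-21, 26, -37, -47, 109, 116, 137, 226]

/-- Ordinates of eight independent points. -/
def ordinate : Fin 8 → ℤ := ![6734, 5883, 6999, 7158, 4134, 3973, 3478, 1191]

lemma nonsingular (i : Fin 8) : curve.Nonsingular (abscissa i : ℚ) (ordinate i : ℚ) := by
  rw [WeierstrassCurve.Affine.nonsingular_iff, WeierstrassCurve.Affine.equation_iff]
  fin_cases i <;> norm_num [abscissa, ordinate]

/-- Eight independent points. -/
noncomputable def point (i : Fin 8) : curve.Point := .some _ _ (nonsingular i)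

/-- Primes modulo which the `2`-division polynomial has the roots listed in `root`. -/
def modulus : Fin 8 → ℕ := ![1789, 4111, 5501, 359, 593, 1153, 587, 659]

/-- Roots of the `2`-division polynomial modulo the primes listed in `modulus`. -/
def root : Fin 8 → ℤ := ![751, 778, 4729, 68, 547, 614, 584, 543]

lemma modulus_prime (j : Fin 8) : (modulus j).Prime := by
  fin_cases j <;> norm_num [modulus]

lemma legendreSym_root (j i : Fin 8) [Fact (modulus j).Prime] :
    legendreSym (modulus j) (abscissa i - root j) = if i = j then -1 else 1 := by
  rw [jacobiSym.legendreSym.to_jacobiSym]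
  fin_cases j <;> fin_cases i <;> simp [modulus, abscissa, root] <;> norm_num

lemma linearIndependent_point : LinearIndependent ℤ point := by
  refine linearIndependent_of_forall_even two_nsmul_eq_zero fun c hc j ↦ ?_
  have : Fact (modulus j).Prime := ⟨modulus_prime j⟩
  refine even_coeff (p := modulus j) (root j) ?_ ?_ (a := abscissa) (fun i ↦ ⟨_, _, rfl⟩)
    (by simp [legendreSym_root]) (fun i hi ↦ by simp [legendreSym_root, hi]) hc
  · fin_cases j <;> norm_num [modulus, root]
  · fin_cases j <;> norm_num [modulus, root]

end RankEight

/-- The elliptic curve `[1, -1, 0, -222751, 40537273]` has discriminant of absolute value `2 * 292246301470558`,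
and its group of rational points contains `8` points that are linearly independent
over `ℤ` (so its Mordell–Weil rank is at least `8`). -/
theorem rank8_low_discriminant_curve2 (W : WeierstrassCurve ℚ)
    (hW : W = ⟨1, -1, 0, -222751, 40537273⟩) :
    |W.Δ| = 2 * 292246301470558 ∧ (2 * 292246301470558 : ℚ) = 584492602941116 ∧
      ∃ P : Fin 8 → W.toAffine.Point, LinearIndependent ℤ P := by
  subst hW
  refine ⟨?_, by norm_num, RankEight.point, RankEight.linearIndependent_point⟩
  norm_num [WeierstrassCurve.Δ, WeierstrassCurve.b₂, WeierstrassCurve.b₄, WeierstrassCurve.b₆,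
    WeierstrassCurve.b₈]
end
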